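/- arXiv:1510.02281 — 2 statements merged into one kernel-verified Lean document; each statement's English description precedes it below -/
import Mathlib

section
/- Let B be a nonempty subset of (0,1) that is closed in ℝ and θ-invariant (B = θ(B)), and suppose that the closure of B_e^c is disjoint from its image under the map ξ ↦ ξ*, i.e. closure(B_e^c) ∩ {ξ* : ξ ∈ closure(B_e^c)} = ∅. Then there exists a continuous 1-periodic function p : ℝ → [0,1] with p(0) = 1 satisfying the QMF condition p(ξ/2) + p(ξ/2 + 1/2) = 1 for every ξ ∈ [0,1], such that p(ξ) = 0 for every ξ ∈ B_e^c (so B is invariant for p), and such that the function Φ̂_p(ξ) := lim_{n→∞} ∏_{j=1}^n p(ξ/2^j) (the limit exists since 0 ≤ p ≤ 1) satisfies: (a) ∑_{k∈ℤ} Φ̂_p(ξ+k) = 1 for Lebesgue-almost every ξ ∈ [0,1], and (b) lim_{j→∞} Φ̂_p(2^{-j}ξ) = 1 for Lebesgue-almost every ξ ∈ ℝ. -/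
open Set MeasureTheory Filter

open Classical in
/-- The doubling map `θ` on `[0,1)`: `θ(ξ) = 2ξ` for `ξ < 1/2`, `2ξ − 1` otherwise. -/
noncomputable def theta (ξ : ℝ) : ℝ := if ξ < 1/2 then 2*ξ else 2*ξ - 1

open Classical in
/-- `ξ* = ξ + 1/2` for `ξ ∈ [0,1/2]` and `ξ − 1/2` for `ξ ∈ (1/2,1]`. -/
noncomputable def starR (ξ : ℝ) : ℝ := if ξ ≤ 1/2 then ξ + 1/2 else ξ - 1/2


/-- `B_e^c = {ξ ∈ (0,1) : ξ ∉ B, θ(ξ) ∈ B}` (exit set relative to the doubling map). -/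
def BeTheta (B : Set ℝ) : Set ℝ := {ξ | ξ ∈ Set.Ioo (0:ℝ) 1 ∧ ξ ∉ B ∧ theta ξ ∈ B}


/-- Partial products. -/
noncomputable def pprod (p : ℝ → ℝ) (n : ℕ) (x : ℝ) : ℝ := ∏ j ∈ Finset.range n, p (x / 2^(j+1))

lemma pprod_succ' (p : ℝ → ℝ) (n : ℕ) (x : ℝ) :
    pprod p (n+1) x = p (x/2) * pprod p n (x/2) := by
  unfold pprod
  rw [Finset.prod_range_succ', mul_comm]
  congr 1
  · simp
  · apply Finset.prod_congr rfl
    intro j _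
    congr 1
    field_simp
    ring

lemma pprod_succ (p : ℝ → ℝ) (n : ℕ) (x : ℝ) :
    pprod p (n+1) x = pprod p n x * p (x/2^(n+1)) := by
  unfold pprod
  rw [Finset.prod_range_succ]

lemma int_even_add_odd {f : ℤ → ℝ} {a b : ℝ} (he : HasSum (fun k ↦ f (2 * k)) a)
    (ho : HasSum (fun k ↦ f (2 * k + 1)) b) : HasSum f (a + b) := by
  have := mul_right_injective₀ (two_ne_zero' ℤ)
  replace ho := ((add_left_injective 1).comp this).hasSum_range_iff.2 ho
  refine (this.hasSum_range_iff.2 he).add_isCompl ?_ ho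
  have e1 : range (fun x : ℤ => 2 * x) = {n : ℤ | Even n} := by
    ext n; simp [even_iff_two_dvd, dvd_def]
  have e2 : range ((fun x : ℤ => x + 1) ∘ fun x : ℤ => 2 * x) = {n : ℤ | Odd n} := by
    ext n; simp [Odd, eq_comm]
  rw [e1, e2]
  exact Int.isCompl_even_odd

structure QData (p : ℝ → ℝ) (δ : ℝ) : Prop where
  mem : ∀ x, p x ∈ Set.Icc (0:ℝ) 1
  per : Function.Periodic p 1
  qmf : ∀ x, p x + p (x + 1/2) = 1
  pos : 0 < δ
  one : ∀ x, |x| ≤ δ → p x = 1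


lemma pprod_nonneg {p : ℝ → ℝ} {δ : ℝ} (h : QData p δ) (n : ℕ) (x : ℝ) : 0 ≤ pprod p n x :=
  Finset.prod_nonneg fun _ _ => (h.mem _).1

lemma pprod_le_one {p : ℝ → ℝ} {δ : ℝ} (h : QData p δ) (n : ℕ) (x : ℝ) : pprod p n x ≤ 1 :=
  Finset.prod_le_one (fun _ _ => (h.mem _).1) (fun _ _ => (h.mem _).2)

lemma pprod_anti {p : ℝ → ℝ} {δ : ℝ} (h : QData p δ) (x : ℝ) : Antitone (fun n => pprod p n x) := by
  apply antitone_nat_of_succ_le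
  intro n
  rw [pprod_succ]
  exact mul_le_of_le_one_right (pprod_nonneg h n x) (h.mem _).2

lemma pprod_per {p : ℝ → ℝ} {δ : ℝ} (h : QData p δ) (n : ℕ) (x : ℝ) : pprod p n (x + 2^n) = pprod p n x := by
  unfold pprod
  apply Finset.prod_congr rfl
  intro j hj
  have hj' : j + 1 ≤ n := Finset.mem_range.1 hj
  have := h.per.nat_mul (2^(n-(j+1))) (x / 2^(j+1))
  rw [← this]
  congr 1
  have h2 : (2:ℝ)^n = 2^(n-(j+1)) * 2^(j+1) := by rw [← pow_add]; congr 1; omega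
  rw [h2]; push_cast; field_simp

lemma pprod_sum {p : ℝ → ℝ} {δ : ℝ} (h : QData p δ) (n : ℕ) (x : ℝ) : ∑ k ∈ Finset.range (2^n), pprod p n (x + k) = 1 := by
  induction n with
  | zero => simp [pprod]
  | succ n ih =>
    rw [pow_succ, mul_two, Finset.sum_range_add, ← Finset.sum_add_distrib, ← ih]
    apply Finset.sum_congr rfl
    intro k _
    rw [pprod_succ, pprod_succ]
    push_cast
    have e : x + (2^n + k : ℝ) = (x + k) + 2^n := by ring
    rw [e, pprod_per h, ← mul_add]
    have e2 : ((x + k) + 2^n : ℝ) / 2^(n+1) = (x+k)/2^(n+1) + 1/2 := by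
      field_simp
      ring
    rw [e2, h.qmf, mul_one]


/-- The infinite product. -/
noncomputable def Phi (p : ℝ → ℝ) (x : ℝ) : ℝ := ⨅ n, pprod p n x


lemma bdd {p : ℝ → ℝ} {δ : ℝ} (h : QData p δ) (x : ℝ) : BddBelow (range fun n => pprod p n x) :=
  ⟨0, by rintro _ ⟨n, rfl⟩; exact pprod_nonneg h n x⟩

lemma Phi_tendsto {p : ℝ → ℝ} {δ : ℝ} (h : QData p δ) (x : ℝ) : Tendsto (fun n => pprod p n x) atTop (nhds (Phi p x)) :=
  tendsto_atTop_ciInf (pprod_anti h x) (bdd h x)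

lemma Phi_le {p : ℝ → ℝ} {δ : ℝ} (h : QData p δ) (n : ℕ) (x : ℝ) : Phi p x ≤ pprod p n x := ciInf_le (bdd h x) n

lemma Phi_nonneg {p : ℝ → ℝ} {δ : ℝ} (h : QData p δ) (x : ℝ) : 0 ≤ Phi p x := le_ciInf fun n => pprod_nonneg h n x

lemma Phi_rec {p : ℝ → ℝ} {δ : ℝ} (h : QData p δ) (x : ℝ) : Phi p x = p (x/2) * Phi p (x/2) := by
  have h1 := (Phi_tendsto h x).comp (tendsto_add_atTop_nat 1)
  have h2 := (Phi_tendsto h (x/2)).const_mul (p (x/2))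
  refine tendsto_nhds_unique h1 (h2.congr fun n => ?_)
  simp [pprod_succ']

lemma Phi_one {p : ℝ → ℝ} {δ : ℝ} (h : QData p δ) (x : ℝ) (hx : |x| ≤ δ) : Phi p x = 1 := by
  have : ∀ n, pprod p n x = 1 := by
    intro n
    apply Finset.prod_eq_one
    intro j _
    apply h.one
    rw [abs_div, abs_of_pos (by positivity : (0:ℝ) < 2^(j+1))]
    exact (div_le_self (abs_nonneg _) (one_le_pow₀ (by norm_num))).trans hx
  simp [Phi, this]

lemma Phi_sum_le {p : ℝ → ℝ} {δ : ℝ} (h : QData p δ) (x : ℝ) (F : Finset ℤ) : ∑ k ∈ F, Phi p (x + k) ≤ 1 := by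
  obtain ⟨m, hm⟩ : ∃ m : ℕ, ∀ k ∈ F, k.natAbs < m := by
    refine ⟨F.sup Int.natAbs + 1, fun k hk => ?_⟩
    exact Nat.lt_succ_of_le (Finset.le_sup (f := Int.natAbs) hk)
  have hm2 : m < 2^m := Nat.lt_two_pow_self
  rw [← pprod_sum h (m+1) (x - m)]
  calc ∑ k ∈ F, Phi p (x + k) ≤ ∑ k ∈ F, pprod p (m+1) (x + k) :=
        Finset.sum_le_sum fun k _ => Phi_le h _ _
    _ = ∑ i ∈ F.image (fun k : ℤ => (k + m).toNat), pprod p (m+1) (x - m + i) := by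
        rw [Finset.sum_image]
        · apply Finset.sum_congr rfl
          intro k hk
          have := hm k hk
          have e : (((k + m).toNat : ℕ) : ℤ) = k + m := Int.toNat_of_nonneg (by omega)
          have e' : (((k + m).toNat : ℕ) : ℝ) = k + m := by exact_mod_cast e
          rw [e']; congr 1; ring
        · intro a ha b hb hab
          have := hm a ha
          have := hm b hb
          simp only at hab
          omega
    _ ≤ _ := by
        apply Finset.sum_le_sum_of_subset_of_nonneg
        · intro i hi
          obtain ⟨k, hk, rfl⟩ := Finset.mem_image.1 hi
          have := hm k hk
          rw [Finset.mem_range, pow_succ]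
          omega
        · intros; exact pprod_nonneg h _ _

lemma Phi_summable {p : ℝ → ℝ} {δ : ℝ} (h : QData p δ) (x : ℝ) : Summable fun k : ℤ => Phi p (x + k) :=
  summable_of_sum_le (fun _ => Phi_nonneg h _) (Phi_sum_le h x)


/-- Periodization. -/
noncomputable def per (p : ℝ → ℝ) (x : ℝ) : ℝ := ∑' k : ℤ, Phi p (x + k)


lemma per_le {p : ℝ → ℝ} {δ : ℝ} (h : QData p δ) (x : ℝ) : per p x ≤ 1 :=
  Real.tsum_le_of_sum_le (fun _ => Phi_nonneg h _) (Phi_sum_le h x)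

lemma per_nonneg {p : ℝ → ℝ} {δ : ℝ} (h : QData p δ) (x : ℝ) : 0 ≤ per p x := tsum_nonneg fun _ => Phi_nonneg h _

lemma per_int {p : ℝ → ℝ} (x : ℝ) (m : ℤ) : per p (x + m) = per p x := by
  unfold per
  rw [← (Equiv.addLeft m).tsum_eq (fun k : ℤ => Phi p (x + k))]
  apply tsum_congr
  intro k
  simp [add_assoc]

lemma per_rec {p : ℝ → ℝ} {δ : ℝ} (h : QData p δ) (x : ℝ) : per p x = p (x/2) * per p (x/2) + p (x/2+1/2) * per p (x/2+1/2) := by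
  refine HasSum.tsum_eq (int_even_add_odd ?_ ?_)
  · have H := (Phi_summable h (x/2)).hasSum.mul_left (p (x/2))
    suffices HH : (fun k : ℤ => Phi p (x + ((2 * k : ℤ) : ℝ))) =
        fun k : ℤ => p (x/2) * Phi p (x/2 + k) by rw [HH]; exact H
    funext k
    rw [Phi_rec h]
    push_cast
    have e : (x + 2 * k)/2 = x/2 + k := by ring
    rw [e]
    have := h.per.int_mul k (x/2)
    rw [mul_one] at this; rw [this]
  · have H := (Phi_summable h (x/2+1/2)).hasSum.mul_left (p (x/2+1/2))
    suffices HH : (fun k : ℤ => Phi p (x + ((2 * k + 1 : ℤ) : ℝ))) =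
        fun k : ℤ => p (x/2+1/2) * Phi p (x/2+1/2 + k) by rw [HH]; exact H
    funext k
    rw [Phi_rec h]
    push_cast
    have e : (x + (2 * k+1))/2 = x/2 + 1/2 + k := by ring
    rw [e]
    have := h.per.int_mul k (x/2+1/2)
    rw [mul_one] at this; rw [this]

lemma per_one {p : ℝ → ℝ} {δ : ℝ} (h : QData p δ) (x : ℝ) (hx : |x| ≤ δ) : per p x = 1 := by
  apply le_antisymm (per_le h x)
  have := (Phi_summable h x).le_tsum 0 (fun _ _ => Phi_nonneg h _)
  simp only [Int.cast_zero, add_zero, Phi_one h x hx] at this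
  exact this

lemma step_bound {p : ℝ → ℝ} {δ : ℝ} (h : QData p δ) {d : ℝ → ℝ} (hd1 : ∀ x, d x / 2 ≤ d (x/2)) (hd2 : ∀ x, d x / 2 ≤ d (x/2+1/2))
    {s r : ℝ} (hr : 0 ≤ r) (hs : ∀ y, r ≤ d y → 1 - per p y ≤ s) (n : ℕ) :
    ∀ x, 2^n * r ≤ d x → 1 - per p x ≤
      pprod p n x * (1 - per p (x/2^n)) + (1 - pprod p n x) * s := by
  induction n with
  | zero => intro x hx; simp [pprod]
  | succ n ih =>
    intro x hx
    have hx' : 2^n * r ≤ d x / 2 := by rw [pow_succ] at hx; linarith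
    have h1 := ih (x/2) (hx'.trans (hd1 x))
    have hrn : r ≤ 2^n * r := le_mul_of_one_le_left hr (one_le_pow₀ (by norm_num))
    have h2 := hs (x/2+1/2) (hrn.trans (hx'.trans (hd2 x)))
    have h3 := h.qmf (x/2)
    have e : x/2/2^n = x/2^(n+1) := by rw [pow_succ]; field_simp
    rw [e] at h1
    rw [per_rec h, pprod_succ']
    have h4 := mul_le_mul_of_nonneg_left h1 (h.mem (x/2)).1
    have h5 := mul_le_mul_of_nonneg_left h2 (h.mem (x/2+1/2)).1
    have h6 : p (x/2+1/2) = 1 - p (x/2) := by linarith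
    rw [h6] at h5 ⊢
    nlinarith

lemma core {p : ℝ → ℝ} {δ : ℝ} (h : QData p δ) {d : ℝ → ℝ} (hd1 : ∀ x, d x / 2 ≤ d (x/2)) (hd2 : ∀ x, d x / 2 ≤ d (x/2+1/2))
    (hd3 : ∀ x (m : ℤ), d (x + m) = d x) (N : ℕ) (hN : 1/2/2^N ≤ δ) (G : ℝ → ℝ)
    (hG : ∀ r, 0 < r → ∀ x, |x| ≤ 1/2 → r ≤ d x → G r ≤ pprod p N x)
    (hdiv : ∀ r, 0 < r → r ≤ 1/16 →
      Tendsto (fun k => ∑ i ∈ Finset.range k, G (r/2^(N*i))) atTop atTop)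
    (x : ℝ) (hx : 0 < d x) : per p x = 1 := by
  have key : ∀ k : ℕ, ∀ r, 0 < r → ∀ x, r ≤ d x →
      1 - per p x ≤ Real.exp (-∑ i ∈ Finset.range k, G (r/2^(N*i))) := by
    intro k
    induction k with
    | zero => intro r _ x _; simpa using per_nonneg h x
    | succ k ih =>
      intro r hr x hx
      have hr' : 0 < r / 2^N := by positivity
      set x' := x + ((-round x : ℤ) : ℝ) with hx'
      have e1 : per p x = per p x' := (per_int x _).symm
      have e2 : d x = d x' := (hd3 x _).symm
      have hx1 : |x'| ≤ 1/2 := by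
        have := abs_sub_round x
        rw [hx']; push_cast; rwa [← sub_eq_add_neg]
      rw [e1]; rw [e2] at hx
      have h1 := step_bound h hd1 hd2 hr'.le (fun y => ih (r/2^N) hr' y) N x'
        (by rw [mul_div_cancel₀ _ (by positivity)]; exact hx)
      have h2 : per p (x'/2^N) = 1 := by
        apply per_one h
        rw [abs_div, abs_of_pos (by positivity : (0:ℝ) < 2^N)]
        exact (by gcongr : |x'|/2^N ≤ 1/2/2^N).trans hN
      rw [h2, sub_self, mul_zero, zero_add] at h1
      refine h1.trans ?_
      rw [Finset.sum_range_succ', neg_add, Real.exp_add, mul_comm]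
      have e3 : ∀ i, r/2^N/2^(N*i) = r/2^(N*(i+1)) := by
        intro i; rw [div_div, ← pow_add]; congr 2; ring
      simp only [e3]
      apply mul_le_mul_of_nonneg_left _ (Real.exp_nonneg _)
      have h3 := hG r hr x' hx1 hx
      have h4 := Real.add_one_le_exp (-(G (r/2^(N*0))))
      simp only [mul_zero, pow_zero, div_one] at h4 ⊢
      linarith
  apply le_antisymm (per_le h x)
  have hr : 0 < min (d x) (1/16) := lt_min hx (by norm_num)
  have ht := Real.tendsto_exp_neg_atTop_nhds_zero.comp (hdiv _ hr (min_le_right _ _))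
  have := ge_of_tendsto' ht (fun k => key k _ hr x (min_le_left _ _))
  linarith

/-- Slowly varying modulus. -/
noncomputable def ell (t : ℝ) : ℝ := (-Real.log (min t (1/16)))⁻¹

lemma ell_zero : ell 0 = 0 := by simp [ell]

lemma log_min_neg {t : ℝ} (ht : 0 < t) : 1 ≤ -Real.log (min t (1/16)) := by
  have h0 : 0 < min t (1/16) := lt_min ht (by norm_num)
  have h1 : Real.log (min t (1/16)) ≤ Real.log (Real.exp (-1)) := by
    apply Real.log_le_log h0
    refine (min_le_right _ _).trans ?_
    rw [Real.exp_neg]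
    rw [one_div]
    apply inv_anti₀ (Real.exp_pos _)
    linarith [Real.exp_one_lt_d9]
  rw [Real.log_exp] at h1
  linarith

lemma ell_pos {t : ℝ} (ht : 0 < t) : 0 < ell t :=
  inv_pos.2 (zero_lt_one.trans_le (log_min_neg ht))

lemma ell_nonneg {t : ℝ} (ht : 0 ≤ t) : 0 ≤ ell t := by
  rcases ht.eq_or_lt with rfl | h
  · rw [ell_zero]
  · exact (ell_pos h).le

lemma ell_le_one {t : ℝ} (ht : 0 ≤ t) : ell t ≤ 1 := by
  rcases ht.eq_or_lt with rfl | h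
  · rw [ell_zero]; norm_num
  · exact inv_le_one_of_one_le₀ (log_min_neg h)

lemma ell_mono {s t : ℝ} (hs : 0 ≤ s) (hst : s ≤ t) : ell s ≤ ell t := by
  rcases hs.eq_or_lt with rfl | h
  · rw [ell_zero]; exact ell_nonneg hst
  · apply inv_anti₀ (zero_lt_one.trans_le (log_min_neg (h.trans_le hst)))
    apply neg_le_neg
    apply Real.log_le_log (lt_min h (by norm_num))
    exact min_le_min_right _ hst

lemma ell_cont : ContinuousOn ell (Ici 0) := by
  intro t ht
  apply ContinuousAt.continuousWithinAt
  rcases (show (0:ℝ) ≤ t from ht).eq_or_lt with rfl | h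
  · rw [continuousAt_iff_punctured_nhds, ell_zero]
    have h1 : Tendsto (fun t : ℝ => (-Real.log t)⁻¹) (nhdsWithin 0 {0}ᶜ) (nhds 0) :=
      tendsto_inv_atTop_zero.comp (tendsto_neg_atBot_atTop.comp Real.tendsto_log_nhdsNE_zero)
    refine h1.congr' ?_
    have : ∀ᶠ t : ℝ in nhds 0, t < 1/16 := eventually_lt_nhds (by norm_num)
    filter_upwards [this.filter_mono nhdsWithin_le_nhds] with t ht
    rw [ell, min_eq_left ht.le]
  · have h0 : min t (1/16) ≠ 0 := (lt_min h (by norm_num)).ne'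
    have h1 : -Real.log (min t (1/16)) ≠ 0 := (zero_lt_one.trans_le (log_min_neg h)).ne'
    unfold ell
    have h2 : ContinuousAt (fun t : ℝ => min t (1/16)) t := by fun_prop
    exact ((h2.log h0).neg).inv₀ h1

lemma ell_div (N : ℕ) (r : ℝ) (hr : 0 < r) (hr1 : r ≤ 1/16) :
    Tendsto (fun k => ∑ i ∈ Finset.range k, (fun r => ell (r/2^(N+3)) / 2^N) (r/2^(N*i)))
      atTop atTop := by
  set C : ℝ := -Real.log r + (N+3) * Real.log 2 with hC
  have hl2 : 0 < Real.log 2 := Real.log_pos (by norm_num)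
  have hlr : Real.log r < 0 := Real.log_neg hr (by linarith)
  have hCpos : 0 < C := by
    have : (0:ℝ) ≤ N := Nat.cast_nonneg _
    have : 0 ≤ ((N:ℝ)+3) * Real.log 2 := by positivity
    linarith
  have base := Real.tendsto_sum_range_one_div_nat_succ_atTop.const_mul_atTop
    (show 0 < (C * 2^N)⁻¹ by positivity)
  refine tendsto_atTop_mono (fun k => ?_) base
  rw [Finset.mul_sum]
  apply Finset.sum_le_sum
  intro i _
  have e : r/2^(N*i)/2^(N+3) = r / 2^(N*i+(N+3)) := by rw [div_div, ← pow_add]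
  have hle : r / 2^(N*i+(N+3)) ≤ 1/16 :=
    (div_le_self hr.le (one_le_pow₀ (by norm_num))).trans hr1
  simp only [e]
  rw [ell, min_eq_left hle, Real.log_div hr.ne' (by positivity), Real.log_pow]
  have h1 : -(Real.log r - ((N*i+(N+3) : ℕ):ℝ) * Real.log 2) ≤ C * (i+1) := by
    rw [hC]; push_cast
    have : (0:ℝ) ≤ i := Nat.cast_nonneg _
    have h3 := mul_nonneg this hl2.le
    have h4 := mul_nonneg this (neg_nonneg.2 hlr.le)
    nlinarith
  have h0 : 0 < -(Real.log r - ((N*i+(N+3) : ℕ):ℝ) * Real.log 2) := by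
    have : 0 ≤ ((N*i+(N+3) : ℕ):ℝ) * Real.log 2 := by positivity
    linarith
  have h2 := inv_anti₀ h0 h1
  calc (C * 2^N)⁻¹ * (1/((i:ℝ)+1)) = (C * (i+1))⁻¹ / 2^N := by
        field_simp
    _ ≤ _ := by gcongr

lemma infDist_per {S : Set ℝ} (hS : ∀ x ∈ S, ∀ m : ℤ, x + m ∈ S) (hne : S.Nonempty)
    (x : ℝ) (m : ℤ) : Metric.infDist (x + m) S = Metric.infDist x S := by
  have key : ∀ (x : ℝ) (m : ℤ), Metric.infDist (x + m) S ≤ Metric.infDist x S := by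
    intro x m
    rw [Metric.le_infDist hne]
    intro y hy
    refine (Metric.infDist_le_dist_of_mem (hS y hy m)).trans ?_
    simp
  apply le_antisymm (key x m)
  have := key (x + m) (-m)
  simpa using this

lemma nu_cont : Continuous fun x : ℝ => |x - round x| := by
  have : (fun x : ℝ => |x - round x|) = fun x : ℝ => ‖(x : UnitAddCircle)‖ := by
    funext x; exact UnitAddCircle.norm_eq.symm
  rw [this]
  exact continuous_norm.comp (AddCircle.continuous_mk' 1)

lemma construct (Bt Et : Set ℝ) (hBc : IsClosed Bt) (hEc : IsClosed Et) (hBne : Bt.Nonempty)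
    (hBper : ∀ x ∈ Bt, ∀ m : ℤ, x + m ∈ Bt) (hEper : ∀ x ∈ Et, ∀ m : ℤ, x + m ∈ Et)
    (hB2 : ∀ x ∈ Bt, 2 * x ∈ Bt) (hE2 : ∀ x ∈ Et, 2 * x ∈ Bt) (h0 : (0:ℝ) ∉ Bt)
    (hE : ∀ x ∈ Et, x + 1/2 ∉ Et) :
    ∃ p : ℝ → ℝ, ∃ δ : ℝ, QData p δ ∧ Continuous p ∧ (∀ x ∈ Et, p x = 0) ∧
      ∀ x, x ∉ Bt → per p x = 1 := by
  have h0E : (0:ℝ) ∈ Etᶜ := fun h => h0 (by simpa using hE2 0 h)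
  obtain ⟨δ', hδ', hball⟩ := Metric.isOpen_iff.1 hEc.isOpen_compl 0 h0E
  obtain ⟨δ, hδ, hδ1, hδE⟩ : ∃ δ : ℝ, 0 < δ ∧ δ ≤ 1/16 ∧ ∀ x ∈ Et, δ < |x - round x| := by
    refine ⟨min (δ'/2) (1/16), by positivity, min_le_right _ _, fun x hx => ?_⟩
    by_contra hcon
    push Not at hcon
    have h1 : x - round x ∈ Metric.ball (0:ℝ) δ' := by
      rw [Metric.mem_ball, Real.dist_eq, sub_zero]
      have := hcon.trans (min_le_left _ _)
      linarith
    apply hball h1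
    have := hEper x hx (-round x)
    simpa [sub_eq_add_neg] using this
  obtain ⟨N, hN0, hN⟩ : ∃ N : ℕ, N ≠ 0 ∧ 1/2/2^N ≤ δ := by
    obtain ⟨n, hn⟩ := exists_pow_lt_of_lt_one hδ (show (1/2:ℝ) < 1 by norm_num)
    refine ⟨n+1, by omega, ?_⟩
    have : (1/2:ℝ)/2^(n+1) = (1/2)^n * (1/4) := by
      rw [pow_succ, div_pow, one_pow]; field_simp; norm_num
    rw [this]
    have : (0:ℝ) < (1/2)^n := by positivity
    linarith
  set W : Set ℝ := {x | |(x + 1/2) - round (x + 1/2)| ≤ δ} with hW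
  set Z : Set ℝ := Et ∪ W with hZ
  have hWc : IsClosed W :=
    isClosed_le (nu_cont.comp (continuous_id.add continuous_const)) continuous_const
  have hZc : IsClosed Z := hEc.union hWc
  have hZne : Z.Nonempty := ⟨1/2, Or.inr (by
    rw [hW, mem_ofPred_eq]
    have : ((1:ℝ)/2+1/2) = 1 := by norm_num
    rw [this]; simp [hδ.le])⟩
  have hWper : ∀ x ∈ W, ∀ m : ℤ, x + m ∈ W := by
    intro x hx m
    rw [hW, mem_ofPred_eq] at hx ⊢
    have : x + m + 1/2 = x + 1/2 + m := by ring
    rw [this, round_add_intCast]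
    push_cast
    rwa [add_sub_add_right_eq_sub]
  have hZper : ∀ x ∈ Z, ∀ m : ℤ, x + m ∈ Z := by
    rintro x (hx | hx) m
    · exact Or.inl (hEper x hx m)
    · exact Or.inr (hWper x hx m)
  have hnu1 : ∀ x : ℝ, |(x + 1/2 + 1/2) - round (x + 1/2 + 1/2)| = |x - round x| := by
    intro x
    have : x + 1/2 + 1/2 = x + 1 := by ring
    rw [this, round_add_one]
    push_cast
    rw [add_sub_add_right_eq_sub]
  have hZdis : ∀ x ∈ Z, x + 1/2 ∉ Z := by
    rintro x (hx | hx) (hx' | hx')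
    · exact hE x hx hx'
    · rw [hW, mem_ofPred_eq, hnu1] at hx'
      exact absurd (hδE x hx) (not_lt.2 hx')
    · exact absurd (hδE _ hx') (not_lt.2 hx)
    · rw [hW, mem_ofPred_eq] at hx
      rw [hW, mem_ofPred_eq, hnu1] at hx'
      have a1 := abs_le.1 (hx.trans hδ1)
      have a2 := abs_le.1 (hx'.trans hδ1)
      have b1 : (0:ℝ) < ((round (x + 1/2) - round x : ℤ) : ℝ) := by push_cast; linarith
      have b2 : ((round (x + 1/2) - round x : ℤ) : ℝ) < 1 := by push_cast; linarith
      have c1 : 0 < round (x + 1/2) - round x := by exact_mod_cast b1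
      have c2 : round (x + 1/2) - round x < 1 := by exact_mod_cast b2
      omega
  have hNinv : (0:ℝ) < (N:ℝ)⁻¹ := by positivity
  set g : ℝ → ℝ := fun t => (ell t)^((N:ℝ)⁻¹) / 2 with hg
  have hg0 : g 0 = 0 := by simp only [hg, ell_zero]; rw [Real.zero_rpow hNinv.ne']; simp
  have hgpos : ∀ t, 0 < t → 0 < g t := fun t ht => by
    have := Real.rpow_pos_of_pos (ell_pos ht) (N:ℝ)⁻¹
    simp only [hg]; linarith
  have hgnn : ∀ t, 0 ≤ t → 0 ≤ g t := fun t ht => by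
    have := Real.rpow_nonneg (ell_nonneg ht) (N:ℝ)⁻¹
    simp only [hg]; linarith
  have hgle : ∀ t, 0 ≤ t → g t ≤ 1/2 := fun t ht => by
    have := Real.rpow_le_one (ell_nonneg ht) (ell_le_one ht) hNinv.le
    simp only [hg]; linarith
  have hgmono : ∀ s t, 0 ≤ s → s ≤ t → g s ≤ g t := fun s t hs hst => by
    have := Real.rpow_le_rpow (ell_nonneg hs) (ell_mono hs hst) hNinv.le
    simp only [hg]; linarith
  have hgpow : ∀ t, 0 ≤ t → (g t)^N = ell t / 2^N := fun t ht => by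
    simp only [hg]; rw [div_pow, Real.rpow_inv_natCast_pow (ell_nonneg ht) hN0]
  have hgcont : ContinuousOn g (Ici 0) :=
    (ell_cont.rpow_const (fun _ _ => Or.inr hNinv.le)).div_const 2
  set f : ℝ → ℝ := fun x => g (Metric.infDist x Z) with hf
  have hfcont : Continuous f :=
    hgcont.comp_continuous (Metric.continuous_infDist_pt Z) (fun x => Metric.infDist_nonneg)
  have hfnn : ∀ x, 0 ≤ f x := fun x => hgnn _ Metric.infDist_nonneg
  have hfle : ∀ x, f x ≤ 1/2 := fun x => hgle _ Metric.infDist_nonneg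
  have hfZ : ∀ x ∈ Z, f x = 0 := fun x hx => by
    simp only [hf, Metric.infDist_zero_of_mem hx, hg0]
  have hfnZ : ∀ x, x ∉ Z → 0 < f x := fun x hx =>
    hgpos _ ((hZc.notMem_iff_infDist_pos hZne).1 hx)
  have hfper : ∀ x, f (x + 1) = f x := fun x => by
    have := infDist_per hZper hZne x 1
    simp only [Int.cast_one] at this
    simp only [hf, this]
  have hden : ∀ x, 0 < f x + f (x + 1/2) := by
    intro x
    by_cases hx : x ∈ Z
    · exact add_pos_of_nonneg_of_pos (hfnn _) (hfnZ _ (hZdis x hx))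
    · exact add_pos_of_pos_of_nonneg (hfnZ x hx) (hfnn _)
  set p : ℝ → ℝ := fun x => f x / (f x + f (x + 1/2)) with hp
  have hQ : QData p δ := by
    refine ⟨fun x => ⟨?_, ?_⟩, fun x => ?_, fun x => ?_, hδ, fun x hx => ?_⟩
    · exact div_nonneg (hfnn _) (hden x).le
    · rw [hp]; exact (div_le_one (hden x)).2 (by linarith [hfnn (x+1/2)])
    · have : x + 1 + 1/2 = x + 1/2 + 1 := by ring
      simp only [hp]
      rw [this, hfper, hfper]
    · have : x + 1/2 + 1/2 = x + 1 := by ring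
      simp only [hp]
      rw [this, hfper, add_comm (f (x+1/2)), ← add_div, div_self (hden x).ne']
    · have : x + 1/2 ∈ Z := by
        right
        rw [hW, mem_ofPred_eq, hnu1]
        have := round_le x 0
        simp only [Int.cast_zero, sub_zero] at this
        exact this.trans hx
      have h1 := hden x
      simp only [hp]
      rw [hfZ _ this, add_zero] at h1 ⊢
      exact div_self h1.ne'
  have hpf : ∀ x, f x ≤ p x := fun x =>
    le_div_self (hfnn x) (hden x) (by linarith [hfle x, hfle (x+1/2)])
  refine ⟨p, δ, hQ, ?_, ?_, ?_⟩
  · exact hfcont.div (hfcont.add (hfcont.comp (continuous_id.add continuous_const)))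
      (fun x => (hden x).ne')
  · intro x hx
    simp only [hp, hfZ x (Or.inl hx), zero_div]
  · set d : ℝ → ℝ := fun x => Metric.infDist x Bt with hd
    have hd3 : ∀ x (m : ℤ), d (x + m) = d x := infDist_per hBper hBne
    have hd2x : ∀ x, d (2*x) / 2 ≤ d x := by
      intro x
      simp only [hd]
      rw [Metric.le_infDist hBne]
      intro y hy
      have := Metric.infDist_le_dist_of_mem (x := 2*x) (hB2 y hy)
      rw [Real.dist_eq, ← mul_sub, abs_mul, abs_two] at this
      rw [Real.dist_eq]; linarith
    have hdE : ∀ x, ∀ y ∈ Et, d (2*x) / 2 ≤ |x - y| := by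
      intro x y hy
      have := Metric.infDist_le_dist_of_mem (x := 2*x) (hE2 y hy)
      rw [Real.dist_eq, ← mul_sub, abs_mul, abs_two] at this
      simp only [hd]; linarith
    have hd1 : ∀ x, d x / 2 ≤ d (x/2) := fun x => by
      have := hd2x (x/2)
      rwa [mul_div_cancel₀ _ (two_ne_zero)] at this
    have hd2 : ∀ x, d x / 2 ≤ d (x/2+1/2) := fun x => by
      have := hd2x (x/2+1/2)
      have e : 2 * (x/2+1/2) = x + ((1:ℤ):ℝ) := by push_cast; ring
      rwa [e, hd3] at this
    have hdle : ∀ x, d x ≤ 1 := by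
      intro x
      obtain ⟨b, hb⟩ := hBne
      refine (Metric.infDist_le_dist_of_mem (hBper b hb (round (x-b)))).trans ?_
      rw [Real.dist_eq]
      have := abs_sub_round (x-b)
      rw [sub_sub] at this
      linarith
    have hdpow : ∀ x (j : ℕ), d x / 2^j ≤ d (x/2^j) := by
      intro x j
      induction j with
      | zero => simp
      | succ j ih =>
        have := hd1 (x/2^j)
        rw [div_div, ← pow_succ] at this
        refine le_trans ?_ this
        rw [pow_succ, ← div_div]
        linarith
    intro x hx
    refine core hQ hd1 hd2 hd3 N hN (fun r => ell (r/2^(N+3)) / 2^N) ?_ (ell_div N) x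
      ((hBc.notMem_iff_infDist_pos hBne).1 hx)
    intro r hr x hx hrx
    have hr' : 0 ≤ r/2^(N+3) := by positivity
    rw [← hgpow _ hr']
    have : (g (r/2^(N+3)))^N = ∏ j ∈ Finset.range N, g (r/2^(N+3)) := by simp
    rw [this]
    apply Finset.prod_le_prod
    · intros; exact hgnn _ hr'
    intro j hj
    have hj' : j < N := Finset.mem_range.1 hj
    refine le_trans (hgmono _ _ hr' ?_) (hpf _)
    rw [Metric.le_infDist hZne]
    intro z hz
    rw [Real.dist_eq]
    rcases hz with hz | hz
    · have a1 := hdE (x/2^(j+1)) z hz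
      have e : 2 * (x/2^(j+1)) = x/2^j := by rw [pow_succ]; field_simp
      rw [e] at a1
      have a2 := hdpow x j
      calc r/2^(N+3) ≤ r/2^(j+1) := by
            apply div_le_div_of_nonneg_left hr.le (by positivity)
            exact pow_le_pow_right₀ (by norm_num) (by omega)
        _ ≤ d x / 2^(j+1) := by gcongr
        _ = d x / 2^j / 2 := by rw [pow_succ, div_div]
        _ ≤ d (x/2^j) / 2 := by gcongr
        _ ≤ _ := a1
    · have a1 : r/2^(N+3) ≤ 1/8 := by
        have : r ≤ 1 := hrx.trans (hdle x)
        calc r/2^(N+3) ≤ 1/2^(N+3) := by gcongr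
          _ ≤ 1/2^3 := by
            apply div_le_div_of_nonneg_left (by norm_num) (by positivity)
            exact pow_le_pow_right₀ (by norm_num) (by omega)
          _ = 1/8 := by norm_num
      have a2 : |x/2^(j+1)| ≤ 1/4 := by
        rw [abs_div, abs_of_pos (by positivity : (0:ℝ) < 2^(j+1))]
        calc |x|/2^(j+1) ≤ (1/2)/2^(j+1) := by gcongr
          _ ≤ (1/2)/2^1 := by
            apply div_le_div_of_nonneg_left (by norm_num) (by positivity)
            exact pow_le_pow_right₀ (by norm_num) (by omega)
          _ = 1/4 := by norm_num
      rw [hW, mem_ofPred_eq] at hz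
      have a3 := abs_le.1 (hz.trans hδ1)
      have a4 := abs_le.1 a2
      refine a1.trans ?_
      rw [le_abs]
      rcases le_or_gt (round (z+1/2)) 0 with hn | hn
      · left
        have : (round (z+1/2) : ℝ) ≤ 0 := by exact_mod_cast hn
        linarith
      · right
        have : (1:ℝ) ≤ (round (z+1/2) : ℝ) := by exact_mod_cast hn
        linarith

/-- Periodic lift of a set. -/
def lift1 (S : Set ℝ) : Set ℝ := {x | ((x : ℝ) : UnitAddCircle) ∈ (fun y : ℝ => (y : UnitAddCircle)) '' S}

lemma mem_lift1 {S : Set ℝ} {x : ℝ} : x ∈ lift1 S ↔ ∃ b ∈ S, ∃ k : ℤ, x = b + k := by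
  unfold lift1
  simp only [mem_ofPred_eq, mem_image]
  apply exists_congr
  intro b
  apply and_congr_right
  intro _
  constructor
  · intro h
    rw [QuotientAddGroup.eq, AddSubgroup.mem_zmultiples_iff] at h
    obtain ⟨k, hk⟩ := h
    refine ⟨k, ?_⟩
    simp only [zsmul_eq_mul, mul_one] at hk
    linarith
  · rintro ⟨k, rfl⟩
    simp

lemma lift1_closed {S : Set ℝ} (hS : IsCompact S) : IsClosed (lift1 S) :=
  ((hS.image (AddCircle.continuous_mk' 1)).isClosed).preimage (AddCircle.continuous_mk' 1)

lemma lift1_per {S : Set ℝ} : ∀ x ∈ lift1 S, ∀ m : ℤ, x + m ∈ lift1 S := by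
  intro x hx m
  obtain ⟨b, hb, k, rfl⟩ := mem_lift1.1 hx
  exact mem_lift1.2 ⟨b, hb, k + m, by push_cast; ring⟩

lemma subset_lift1 {S : Set ℝ} : S ⊆ lift1 S := fun x hx => mem_lift1.2 ⟨x, hx, 0, by simp⟩

lemma lift1_null {B : Set ℝ} (hc : IsCompact B) (h2 : ∀ x ∈ lift1 B, 2 * x ∈ lift1 B)
    (h0 : (0:ℝ) ∉ lift1 B) : volume (lift1 B ∩ Set.Ioc 0 1) = 0 := by
  set BC : Set UnitAddCircle := (fun y : ℝ => (y : UnitAddCircle)) '' B with hBC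
  have hcl : IsClosed BC := (hc.image (AddCircle.continuous_mk' 1)).isClosed
  have herg : Ergodic fun y : UnitAddCircle => 2 • y := AddCircle.ergodic_nsmul (by norm_num)
  have hsub : BC ⊆ (fun y : UnitAddCircle => 2 • y) ⁻¹' BC := by
    rintro _ ⟨b, hb, rfl⟩
    have := h2 b (subset_lift1 hb)
    have e : ((2 * b : ℝ) : UnitAddCircle) = 2 • (b : UnitAddCircle) := by
      rw [two_mul, two_nsmul, AddCircle.coe_add]
    simp only [mem_preimage]
    rw [← e]; exact this
  have hnull : volume BC = 0 := by
    rcases herg.ae_empty_or_univ_of_ae_le_preimage hcl.measurableSet.nullMeasurableSet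
      hsub.eventuallyLE with h | h
    · exact ae_eq_empty.1 h
    · exfalso
      have h1 : volume BCᶜ = 0 := ae_eq_univ.1 h
      have h3 : BCᶜ = ∅ := (hcl.isOpen_compl.measure_eq_zero_iff volume).1 h1
      have h4 : ((0:ℝ) : UnitAddCircle) ∈ BCᶜ := h0
      rw [h3] at h4
      exact h4
  have hmp := UnitAddCircle.measurePreserving_mk 0
  have h5 := hmp.measure_preimage hcl.measurableSet.nullMeasurableSet
  rw [hnull, Measure.restrict_apply (hmp.measurable hcl.measurableSet), zero_add] at h5
  exact h5

/-- **Theorem 1.** Every closed `θ`-invariant `B ⊂ (0,1)` with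
`closure(B_e^c) ∩ (closure(B_e^c))* = ∅` is invariant for some continuous QMF function
`p ∈ 𝒬^MRA`, i.e. `p` is continuous, `1`-periodic, `p(0)=1`, satisfies the QMF condition,
vanishes on `B_e^c`, and the infinite product `Φ̂_p` satisfies conditions (a) and (b). -/
theorem exists_continuous_QMF_MRA_with_invariant_set
    (B : Set ℝ) (hne : B.Nonempty) (hsub : B ⊆ Set.Ioo 0 1)
    (hcl : IsClosed B) (hinv : B = theta '' B)
    (hdisj : closure (BeTheta B) ∩ (starR '' closure (BeTheta B)) = ∅) :
    ∃ p : ℝ → ℝ, Continuous p ∧ (∀ ξ, p ξ ∈ Set.Icc (0:ℝ) 1) ∧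
      Function.Periodic p 1 ∧ p 0 = 1 ∧
      (∀ ξ ∈ Set.Icc (0:ℝ) 1, p (ξ/2) + p (ξ/2 + 1/2) = 1) ∧
      (∀ ξ ∈ BeTheta B, p ξ = 0) ∧
      ∃ Φ : ℝ → ℝ,
        (∀ ξ : ℝ, Tendsto (fun n : ℕ => ∏ j ∈ Finset.range n, p (ξ / 2^(j+1)))
          atTop (nhds (Φ ξ))) ∧
        (∀ᵐ ξ ∂(volume.restrict (Set.Icc (0:ℝ) 1)), ∑' k : ℤ, Φ (ξ + (k : ℝ)) = 1) ∧
        (∀ᵐ ξ ∂(volume : Measure ℝ), Tendsto (fun j : ℕ => Φ (ξ / 2^j)) atTop (nhds 1)) := by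
  have hBK : IsCompact B := by
    refine Metric.isCompact_of_isClosed_isBounded hcl ((Metric.isBounded_Icc 0 1).subset ?_)
    exact hsub.trans Ioo_subset_Icc_self
  set E := closure (BeTheta B) with hE
  have hEsub : E ⊆ Set.Icc 0 1 :=
    closure_minimal (fun x hx => Ioo_subset_Icc_self hx.1) isClosed_Icc
  have hEK : IsCompact E := isCompact_Icc.of_isClosed_subset isClosed_closure hEsub
  have hBcl := lift1_closed hBK
  have hth : ∀ x : ℝ, theta x ∈ B → 2 * x ∈ lift1 B := by
    intro x hx
    unfold theta at hx
    split_ifs at hx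
    · exact subset_lift1 hx
    · exact mem_lift1.2 ⟨_, hx, 1, by push_cast; ring⟩
  have hlift2 : ∀ S : Set ℝ, (∀ x ∈ S, 2 * x ∈ lift1 B) → ∀ x ∈ lift1 S, 2 * x ∈ lift1 B := by
    intro S hS x hx
    obtain ⟨b, hb, k, rfl⟩ := mem_lift1.1 hx
    have := lift1_per _ (hS b hb) (2*k)
    push_cast at this
    rwa [mul_add]
  have hB2 : ∀ x ∈ lift1 B, 2 * x ∈ lift1 B := hlift2 B fun x hx => hth x (by
    rw [hinv]; exact ⟨x, hx, rfl⟩)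
  have hE2 : ∀ x ∈ lift1 E, 2 * x ∈ lift1 B := hlift2 E (by
    have hc : IsClosed ((fun x : ℝ => 2 * x) ⁻¹' lift1 B) :=
      hBcl.preimage (continuous_const.mul continuous_id)
    exact closure_minimal (fun x hx => hth x hx.2.2) hc)
  have hIcc : ∀ x ∈ Set.Icc (0:ℝ) 1, x ∈ lift1 B → x ∈ B := by
    intro x hx hxB
    obtain ⟨b, hb, k, rfl⟩ := mem_lift1.1 hxB
    have hb' := hsub hb
    have k1 : (-1:ℝ) < k := by linarith [hx.1, hb'.2]
    have k2 : (k:ℝ) < 1 := by linarith [hx.2, hb'.1]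
    have k1' : -1 < k := by exact_mod_cast k1
    have k2' : k < 1 := by exact_mod_cast k2
    have : k = 0 := by omega
    subst this
    simpa using hb
  have h0 : (0:ℝ) ∉ lift1 B := fun h => lt_irrefl _ (hsub (hIcc 0 (by simp) h)).1
  have hEd : ∀ x ∈ lift1 E, x + 1/2 ∉ lift1 E := by
    intro x hx hx'
    obtain ⟨a, ha, k, rfl⟩ := mem_lift1.1 hx
    obtain ⟨b, hb, m, hm⟩ := mem_lift1.1 hx'
    have ha' := hEsub ha
    have hb' := hEsub hb
    have hmk : ((m - k : ℤ) : ℝ) = a + 1/2 - b := by push_cast; linarith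
    have k1 : (-1:ℝ) < ((m - k : ℤ) : ℝ) := by rw [hmk]; linarith [ha'.1, hb'.2]
    have k2 : ((m - k : ℤ) : ℝ) < 2 := by rw [hmk]; linarith [ha'.2, hb'.1]
    have k1' : -1 < m - k := by exact_mod_cast k1
    have k2' : m - k < 2 := by exact_mod_cast k2
    have hcases : m - k = 0 ∨ m - k = 1 := by omega
    rcases hcases with h | h
    · rw [h] at hmk
      push_cast at hmk
      have : b ∈ E ∩ starR '' E := by
        refine ⟨hb, a, ha, ?_⟩
        rw [starR, if_pos (by linarith [hb'.2])]
        linarith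
      rw [hdisj] at this
      exact this
    · rw [h] at hmk
      push_cast at hmk
      have : a ∈ E ∩ starR '' E := by
        refine ⟨ha, b, hb, ?_⟩
        rw [starR, if_pos (by linarith [ha'.2])]
        linarith
      rw [hdisj] at this
      exact this
  obtain ⟨p, δ, hQ, hpc, hpE, hper⟩ := construct (lift1 B) (lift1 E) hBcl (lift1_closed hEK)
    (hne.mono subset_lift1) lift1_per lift1_per hB2 hE2 h0 hEd
  refine ⟨p, hpc, hQ.mem, hQ.per, hQ.one 0 (by simpa using hQ.pos.le), fun ξ _ => hQ.qmf _,
    fun ξ hξ => hpE ξ (subset_lift1 (subset_closure hξ)), Phi p, Phi_tendsto hQ, ?_, ?_⟩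
  · have hnull : volume B = 0 := by
      refine measure_mono_null (fun x hx => ?_) (lift1_null hBK hB2 h0)
      exact ⟨subset_lift1 hx, Ioo_subset_Ioc_self (hsub hx)⟩
    rw [ae_restrict_iff' measurableSet_Icc]
    filter_upwards [measure_eq_zero_iff_ae_notMem.1 hnull] with ξ hξ hξI
    exact hper ξ fun h => hξ (hIcc ξ hξI h)
  · refine Eventually.of_forall fun ξ => ?_
    apply tendsto_const_nhds.congr'
    have ht : Tendsto (fun j : ℕ => ξ / 2^j) atTop (nhds 0) :=
      tendsto_const_nhds.div_atTop (tendsto_pow_atTop_atTop_of_one_lt (by norm_num))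
    filter_upwards [ht (Metric.closedBall_mem_nhds 0 hQ.pos)] with j hj
    have : |ξ/2^j| ≤ δ := by simpa [abs_div] using hj
    exact (Phi_one hQ _ this).symm
end

section
/- Let J ≥ 1 and let E be a nonempty, closed, proper subset of X = {0,…,J}^{ℤ₋}. Then the set E_e^c of exit points of E is nonempty; in fact, for every ξ ∈ E there exist finitely many symbols a₁,…,a_n ∈ {0,…,J} (n ≥ 1) such that the point obtained from ξ by successively appending a₁,…,a_n (i.e. ξ·a₁·…·a_n) is an exit point of E. -/
open Set Topology

def shiftX {J : ℕ} (ξ : ℕ → Fin (J+1)) : ℕ → Fin (J+1) := fun n => ξ (n+1)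

def consX {J : ℕ} (a : Fin (J+1)) (ξ : ℕ → Fin (J+1)) : ℕ → Fin (J+1) :=
  fun n => match n with
  | 0 => a
  | m+1 => ξ m

def starX {J : ℕ} (j : Fin (J+1)) (ξ : ℕ → Fin (J+1)) : ℕ → Fin (J+1) :=
  fun n => match n with
  | 0 => ξ 0 + j
  | m+1 => ξ (m+1)

/-- The set of exit points of `E`: points outside `E` whose shift lies in `E`. -/
def exitX {J : ℕ} (E : Set (ℕ → Fin (J+1))) : Set (ℕ → Fin (J+1)) :=
  {ξ | ξ ∉ E ∧ shiftX ξ ∈ E}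

/-- A subshift: a nonempty, closed, proper, shift-invariant subset. -/
def IsSubshift {J : ℕ} (K : Set (ℕ → Fin (J+1))) : Prop :=
  K.Nonempty ∧ IsClosed K ∧ K ≠ Set.univ ∧ K = shiftX '' K

/-- The word `(w₁,…,w_m)` occurs in `ξ` if for some `i ≥ 0` the consecutive
coordinates `(ξ(i+m−1),…,ξ(i))` equal `(w₁,…,w_m)`. -/
def OccursX {J : ℕ} (w : List (Fin (J+1))) (ξ : ℕ → Fin (J+1)) : Prop :=
  ∃ i : ℕ, ∀ k, k < w.length → ξ (i + k) = w.reverse.getD k 0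

/-- A subshift of finite type: defined by a finite nonempty set of forbidden words. -/
def IsFiniteType {J : ℕ} (K : Set (ℕ → Fin (J+1))) : Prop :=
  ∃ F : Finset (List (Fin (J+1))), F.Nonempty ∧ K = {ξ | ∀ w ∈ F, ¬ OccursX w ξ}


theorem exists_append_agree {J : ℕ} (ξ : ℕ → Fin (J+1)) (n : ℕ) :
    ∀ η : ℕ → Fin (J+1), ∃ l : List (Fin (J+1)), ∀ k < n,
      l.foldl (fun η a => consX a η) ξ k = η k := by
  induction n with
  | zero => intro η; exact ⟨[], by simp⟩
  | succ n ih =>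
    intro η
    obtain ⟨l, hl⟩ := ih (fun m => η (m+1))
    refine ⟨l ++ [η 0], ?_⟩
    intro k hk
    rw [List.foldl_append]
    cases k with
    | zero => rfl
    | succ k => exact hl k (by omega)

/-- If `E` is a nonempty, closed, proper subset of `X`, then `E_e^c ≠ ∅`;
in fact every `ξ ∈ E` extends, by appending finitely many symbols, to an exit point of `E`. -/
theorem exitPoints_nonempty_of_closed_proper {J : ℕ} (hJ : 1 ≤ J)
    (E : Set (ℕ → Fin (J+1))) (hne : E.Nonempty) (hcl : IsClosed E) (hpr : E ≠ Set.univ) :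
    (exitX E).Nonempty ∧
      ∀ ξ ∈ E, ∃ l : List (Fin (J+1)), l ≠ [] ∧
        l.foldl (fun η a => consX a η) ξ ∈ exitX E := by
  have key : ∀ ξ ∈ E, ∃ l : List (Fin (J+1)), l ≠ [] ∧
        l.foldl (fun η a => consX a η) ξ ∈ exitX E := by
    intro ξ hξ
    by_contra hcon
    have hall : ∀ l : List (Fin (J+1)), l.foldl (fun η a => consX a η) ξ ∈ E := by
      intro l
      induction l using List.reverseRecOn with
      | nil => exact hξ
      | append_singleton l a ih =>
        by_contra hn
        refine hcon ⟨l ++ [a], by simp, hn, ?_⟩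
        rw [List.foldl_append]
        exact ih
    apply hpr
    rw [Set.eq_univ_iff_forall]
    intro η
    choose l hl using fun n => exists_append_agree ξ n η
    refine hcl.mem_of_tendsto (b := Filter.atTop)
      (f := fun n => (l n).foldl (fun η a => consX a η) ξ) ?_
      (Filter.Eventually.of_forall fun n => hall (l n))
    rw [tendsto_pi_nhds]
    intro k
    apply tendsto_const_nhds.congr'
    filter_upwards [Filter.eventually_gt_atTop k] with n hn
    exact (hl n k hn).symm
  refine ⟨?_, key⟩
  obtain ⟨ξ, hξ⟩ := hne
  obtain ⟨l, -, h⟩ := key ξ hξ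
  exact ⟨_, h⟩
end
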